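/- For every positive integer n, n times the number of partitions of n equals the sum over k from 1 to n of σ(k) times the number of partitions of n − k, where σ(k) is the sum of the divisors of k: n · p(n) = Σ_{k=1}^{n} σ(k) · p(n − k). -/

import Mathlib

namespace Nat.Partition

/-- Removing `j` copies of `d` is a bijection from the partitions of `n` with at least `j` parts
equal to `d` onto the partitions of `n - d * j`. -/
theorem card_filter_le_count {n d j : ℕ} (hd : 0 < d) (h : d * j ≤ n) :
    (Finset.univ.filter fun p : n.Partition ↦ j ≤ p.parts.count d).card =
      Fintype.card (n - d * j).Partition := by
  rw [← Finset.card_univ]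
  refine Finset.card_bij' (s := Finset.univ.filter fun p : n.Partition ↦ j ≤ p.parts.count d)
    (t := (Finset.univ : Finset (n - d * j).Partition))
    (fun p hp ↦ ⟨p.parts - Multiset.replicate j d,
      fun {i} hi ↦ p.parts_pos (Multiset.mem_of_le (Multiset.sub_le_self _ _) hi), ?_⟩)
    (fun q _ ↦ ⟨q.parts + Multiset.replicate j d, fun {i} hi ↦ ?_, ?_⟩) ?_ ?_ ?_ ?_
  · have hle : Multiset.replicate j d ≤ p.parts :=
      Multiset.le_count_iff_replicate_le.1 (Finset.mem_filter.1 hp).2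
    have hsum := congrArg Multiset.sum (tsub_add_cancel_of_le hle)
    rw [Multiset.sum_add, Multiset.sum_replicate, p.parts_sum, smul_eq_mul, mul_comm j d] at hsum
    omega
  · rcases Multiset.mem_add.1 hi with hi | hi
    · exact q.parts_pos hi
    · rwa [Multiset.eq_of_mem_replicate hi]
  · rw [Multiset.sum_add, Multiset.sum_replicate, q.parts_sum, smul_eq_mul, mul_comm j d]
    omega
  · simp
  · simp
  · intro p hp
    ext1
    exact tsub_add_cancel_of_le
      (Multiset.le_count_iff_replicate_le.1 (Finset.mem_filter.1 hp).2)
  · intro q _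
    ext1
    exact add_tsub_cancel_right _ _

theorem mul_count_le {n : ℕ} (p : n.Partition) (d : ℕ) : d * p.parts.count d ≤ n := by
  obtain ⟨s, hs⟩ := Multiset.le_iff_exists_add.1
    (Multiset.le_count_iff_replicate_le.1 (le_refl (p.parts.count d)))
  have hsum := congrArg Multiset.sum hs
  rw [Multiset.sum_add, Multiset.sum_replicate, p.parts_sum, smul_eq_mul, mul_comm] at hsum
  omega

theorem sum_mul_count {n : ℕ} (p : n.Partition) :
    ∑ d ∈ Finset.Icc 1 n, d * p.parts.count d = n := by
  conv_rhs => rw [← p.parts_sum]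
  rw [Finset.sum_multiset_count_of_subset p.parts (Finset.Icc 1 n)]
  · simp [mul_comm]
  · intro d hd
    rw [Multiset.mem_toFinset] at hd
    exact Finset.mem_Icc.2 ⟨p.parts_pos hd, p.le_of_mem_parts hd⟩

theorem count_eq_card_multiples {n d : ℕ} (p : n.Partition) (hd : 0 < d) :
    p.parts.count d =
      ((Finset.Icc 1 n).filter fun k ↦ d ∣ k ∧ k / d ≤ p.parts.count d).card := by
  conv_lhs => rw [← Nat.add_sub_cancel (n := p.parts.count d) (m := 1), ← Nat.card_Icc]
  refine Finset.card_bij (fun j _ ↦ d * j) ?_ ?_ ?_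
  · intro j hj
    rw [Finset.mem_Icc] at hj
    have := Nat.mul_le_mul_left d hj.2
    have := p.mul_count_le d
    have := Nat.mul_pos hd hj.1
    simp only [Finset.mem_filter, Finset.mem_Icc, Nat.mul_div_cancel_left j hd]
    exact ⟨⟨by omega, by omega⟩, dvd_mul_right d j, hj.2⟩
  · intro i _ j _ hij
    exact Nat.eq_of_mul_eq_mul_left hd hij
  · intro k hk
    simp only [Finset.mem_filter, Finset.mem_Icc] at hk
    obtain ⟨⟨hk1, -⟩, hdk, hle⟩ := hk
    exact ⟨k / d, Finset.mem_Icc.2 ⟨Nat.div_pos (Nat.le_of_dvd hk1 hdk) hd, hle⟩,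
      Nat.mul_div_cancel' hdk⟩

end Nat.Partition

/-- Euler's recursion for the partition function: for every positive integer `n`,
`n · p(n) = ∑_{k=1}^{n} σ(k) · p(n − k)`, where `σ(k)` is the sum of the divisors
of `k` and `p` is the number of integer partitions. -/
theorem partition_sigma_recursion (n : ℕ) (hn : 0 < n) :
    n * Fintype.card (Nat.Partition n) =
      ∑ k ∈ Finset.Icc 1 n,
        ArithmeticFunction.sigma 1 k * Fintype.card (Nat.Partition (n - k)) := by
  calc n * Fintype.card (Nat.Partition n)
      = ∑ p : n.Partition, ∑ d ∈ Finset.Icc 1 n, d * p.parts.count d := by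
        simp [Nat.Partition.sum_mul_count, mul_comm]
    _ = ∑ p : n.Partition, ∑ d ∈ Finset.Icc 1 n, ∑ k ∈ Finset.Icc 1 n,
          if d ∣ k ∧ k / d ≤ p.parts.count d then d else 0 := by
        refine Finset.sum_congr rfl fun p _ ↦ Finset.sum_congr rfl fun d hd ↦ ?_
        rw [← Finset.sum_filter, Finset.sum_const, smul_eq_mul,
          ← p.count_eq_card_multiples (Finset.mem_Icc.1 hd).1, mul_comm]
    _ = ∑ k ∈ Finset.Icc 1 n, ∑ d ∈ Finset.Icc 1 n, ∑ p : n.Partition,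
          if d ∣ k ∧ k / d ≤ p.parts.count d then d else 0 := by
        rw [Finset.sum_comm, Finset.sum_comm (s := Finset.Icc 1 n) (t := Finset.Icc 1 n)]
        exact Finset.sum_congr rfl fun d _ ↦ Finset.sum_comm
    _ = _ := by
        refine Finset.sum_congr rfl fun k hk ↦ ?_
        rw [Finset.mem_Icc] at hk
        have hdiv : k.divisors = (Finset.Icc 1 n).filter (· ∣ k) := by
          ext d
          simp only [Nat.mem_divisors, Finset.mem_filter, Finset.mem_Icc]
          refine ⟨fun h ↦ ⟨⟨Nat.pos_of_dvd_of_pos h.1 hk.1,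
            (Nat.le_of_dvd hk.1 h.1).trans hk.2⟩, h.1⟩, fun h ↦ ⟨h.2, by omega⟩⟩
        rw [ArithmeticFunction.sigma_one_apply, Finset.sum_mul, hdiv, Finset.sum_filter]
        refine Finset.sum_congr rfl fun d hd ↦ ?_
        split_ifs with hdk
        · have hmul := Nat.mul_div_cancel' hdk
          have hcard := Nat.Partition.card_filter_le_count (n := n) (j := k / d)
            (Finset.mem_Icc.1 hd).1 (hmul.trans_le hk.2)
          rw [hmul] at hcard
          simp only [hdk, true_and]
          rw [← Finset.sum_filter, Finset.sum_const, hcard, smul_eq_mul, mul_comm]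
        · simp [hdk]
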